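/- arXiv:2101.06388 — 6 statements merged into one kernel-verified Lean document; each statement's English description precedes it below -/
import Mathlib

section
/- Let P be an n×n probability matrix with ER-type core–periphery structure and suppose h(n) > p*. Let Q be any n×n real matrix satisfying ‖(Q − P) H‖_{2,∞} < (h(n) − p*)/2. Then min_{i∈𝒞} ‖Q_{i,*} H‖₂ > max_{i∈𝒫} ‖Q_{i,*} H‖₂; consequently, the set of N_𝒞 indices with the largest scores ‖Q_{i,*} H‖₂ is exactly the core set 𝒞. -/
open Matrix MeasureTheory ProbabilityTheory

noncomputable section

/-- Euclidean norm of the `i`-th row of a matrix. -/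
def rowNorm {n m : ℕ} (M : Matrix (Fin n) (Fin m) ℝ) (i : Fin n) : ℝ :=
  Real.sqrt (∑ j, (M i j) ^ 2)

/-- Two-to-infinity norm: maximum Euclidean norm of the rows. -/
def twoInf {n m : ℕ} (M : Matrix (Fin n) (Fin m) ℝ) : ℝ :=
  ⨆ i, rowNorm M i

/-- Spectral norm of a square real matrix. -/
def specNorm {n : ℕ} (M : Matrix (Fin n) (Fin n) ℝ) : ℝ :=
  ‖LinearMap.toContinuousLinearMap (Matrix.toEuclideanLin M)‖

/-- Frobenius norm. -/
def frobNorm {n : ℕ} (M : Matrix (Fin n) (Fin n) ℝ) : ℝ :=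
  Real.sqrt (∑ i, ∑ j, (M i j) ^ 2)

/-- The centering matrix `H = I - (1/n) 11ᵗ`. -/
def centerH (n : ℕ) : Matrix (Fin n) (Fin n) ℝ :=
  1 - (n : ℝ)⁻¹ • Matrix.of (fun _ _ => (1 : ℝ))

/-- A probability matrix: symmetric, entries in `[0,1]`, zero diagonal. -/
def IsProbMatrix {n : ℕ} (P : Matrix (Fin n) (Fin n) ℝ) : Prop :=
  P.IsSymm ∧ (∀ i j, 0 ≤ P i j) ∧ (∀ i j, P i j ≤ 1) ∧ (∀ i, P i i = 0)

/-- Maximum entry `p* = max_{i,j} P_ij`. -/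
def pstar {n : ℕ} (P : Matrix (Fin n) (Fin n) ℝ) : ℝ := ⨆ i, ⨆ j, P i j

/-- Expected degree `d_i = Σ_j P_ij`. -/
def deg {n : ℕ} (P : Matrix (Fin n) (Fin n) ℝ) (i : Fin n) : ℝ := ∑ j, P i j

open Classical in
/-- ER-type periphery set. -/
def peripheryER {n : ℕ} (P : Matrix (Fin n) (Fin n) ℝ) : Finset (Fin n) :=
  Finset.univ.filter fun i => ∀ j k, j ≠ i → k ≠ i → P i j = P i k

/-- ER-type core set. -/
def coreER {n : ℕ} (P : Matrix (Fin n) (Fin n) ℝ) : Finset (Fin n) :=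
  (peripheryER P)ᶜ

/-- `h(n) = min_{i ∈ core} ‖P_{i,*} H‖₂`. -/
def hSignal {n : ℕ} (P : Matrix (Fin n) (Fin n) ℝ) : ℝ :=
  ⨅ i : {i // i ∈ coreER P}, rowNorm (P * centerH n) i.1

open Classical in
/-- Configuration-type periphery set. -/
def peripheryConfig {n : ℕ} (P : Matrix (Fin n) (Fin n) ℝ) : Finset (Fin n) :=
  Finset.univ.filter fun i => ∀ j, j ≠ i → P i j = deg P i * deg P j / ∑ k, deg P k

/-- Configuration-type core set. -/
def coreConfig {n : ℕ} (P : Matrix (Fin n) (Fin n) ℝ) : Finset (Fin n) :=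
  (peripheryConfig P)ᶜ

/-- Diagonal matrix with entries `(d i)⁻¹`, i.e. `D⁻¹`. -/
def degInv {n : ℕ} (d : Fin n → ℝ) : Matrix (Fin n) (Fin n) ℝ :=
  Matrix.diagonal fun i => (d i)⁻¹

/-- `h'(n) = min_{i ∈ core} ‖P_{i,*} D⁻¹ H‖₂`. -/
def hSignal' {n : ℕ} (P : Matrix (Fin n) (Fin n) ℝ) : ℝ :=
  ⨅ i : {i // i ∈ coreConfig P}, rowNorm (P * degInv (deg P) * centerH n) i.1

/-- Eigendecomposition `P = V Λ Vᵗ` with eigenvalues ordered by decreasing absolute value. -/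
def IsEigenDecomp {n : ℕ} (P V : Matrix (Fin n) (Fin n) ℝ) (lam : Fin n → ℝ) : Prop :=
  V * Vᵀ = 1 ∧ P = V * Matrix.diagonal lam * Vᵀ ∧
    ∀ i j : Fin n, i ≤ j → |lam j| ≤ |lam i|

/-- `T` is a rank-`r` spectral truncation of `A`: it retains, from an eigendecomposition of `A`
ordered by decreasing absolute value, the `r` leading eigenvalues and their eigenvectors. -/
def IsSpecTrunc {n : ℕ} (r : ℕ) (A T : Matrix (Fin n) (Fin n) ℝ) : Prop :=
  ∃ (W : Matrix (Fin n) (Fin n) ℝ) (mu : Fin n → ℝ), IsEigenDecomp A W mu ∧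
    T = W * Matrix.diagonal (fun i : Fin n => if (i : ℕ) < r then mu i else 0) * Wᵀ

/-- `U`: the `n × r` matrix of the top-`r` eigenvectors (first `r` columns of `V`). -/
def topEig {n : ℕ} (V : Matrix (Fin n) (Fin n) ℝ) (r : ℕ) (h : r ≤ n) :
    Matrix (Fin n) (Fin r) ℝ :=
  fun i k => V i (Fin.castLE h k)

/-- `A` is a random adjacency matrix generated from `P`: symmetric, zero diagonal, 0/1 entries,
with `A_ij ~ Bernoulli(P_ij)` independently over pairs `i < j`. -/
def IsAdjacencyModel {n : ℕ} {Ω : Type*} [MeasurableSpace Ω] (μ : Measure Ω)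
    (P : Matrix (Fin n) (Fin n) ℝ) (A : Ω → Matrix (Fin n) (Fin n) ℝ) : Prop :=
  (∀ ω, (A ω).IsSymm) ∧ (∀ ω i, A ω i i = 0) ∧
  (∀ ω i j, A ω i j = 0 ∨ A ω i j = 1) ∧
  (∀ i j : Fin n, Measurable fun ω => A ω i j) ∧
  (∀ i j : Fin n, i < j → μ {ω | A ω i j = 1} = ENNReal.ofReal (P i j)) ∧
  iIndepFun
    (fun (p : {q : Fin n × Fin n // q.1 < q.2}) => fun ω => A ω p.1.1 p.1.2) μ

/-- Exact recovery: every core score strictly exceeds every non-core score, so the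
`N_core` indices with largest scores are exactly the core. -/
def ExactRecovery {n : ℕ} (S : Fin n → ℝ) (core : Finset (Fin n)) : Prop :=
  ∀ i ∈ core, ∀ j ∉ core, S j < S i

/-- `B(r) = 10 min{r, 1 + log₂ ratio}` where `ratio = |λ₁/λ_r|`. -/
def Bconst (ratio : ℝ) (r : ℕ) : ℝ := 10 * min (r : ℝ) (1 + Real.logb 2 ratio)

lemma rowNorm_eq_norm {n m : ℕ} (M : Matrix (Fin n) (Fin m) ℝ) (i : Fin n) :
    rowNorm M i = ‖WithLp.toLp 2 (M i)‖ := by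
  simp [rowNorm, EuclideanSpace.norm_eq]

lemma rowNorm_add_le {n m : ℕ} (M N : Matrix (Fin n) (Fin m) ℝ) (i : Fin n) :
    rowNorm (M + N) i ≤ rowNorm M i + rowNorm N i := by
  simp only [rowNorm_eq_norm]
  exact norm_add_le (WithLp.toLp 2 (M i)) (WithLp.toLp 2 (N i))

lemma rowNorm_neg {n m : ℕ} (M : Matrix (Fin n) (Fin m) ℝ) (i : Fin n) :
    rowNorm (-M) i = rowNorm M i := by
  simp [rowNorm]

lemma mul_centerH_apply {n : ℕ} (M : Matrix (Fin n) (Fin n) ℝ) (i k : Fin n) :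
    (M * centerH n) i k = M i k - (n : ℝ)⁻¹ * ∑ l, M i l := by
  rw [centerH, Matrix.mul_sub, Matrix.mul_one, Matrix.sub_apply, Matrix.mul_apply, Finset.mul_sum]
  congr 1
  refine Finset.sum_congr rfl fun l _ => ?_
  simp [mul_comm]

lemma rowNorm_le_twoInf {n m : ℕ} (M : Matrix (Fin n) (Fin m) ℝ) (i : Fin n) :
    rowNorm M i ≤ twoInf M :=
  le_ciSup (f := fun i => rowNorm M i) (Set.finite_range _).bddAbove i

lemma entry_le_pstar {n : ℕ} (P : Matrix (Fin n) (Fin n) ℝ) (i j : Fin n) :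
    P i j ≤ pstar P :=
  (le_ciSup (f := fun j => P i j) (Set.finite_range _).bddAbove j).trans
    (le_ciSup (f := fun i => ⨆ j, P i j) (Set.finite_range _).bddAbove i)

lemma sum_sq_center_le {n : ℕ} (hn : 2 ≤ n) (x : Fin n → ℝ) (c : ℝ) :
    ∑ k, (x k - (n : ℝ)⁻¹ * ∑ l, x l) ^ 2 ≤ ∑ k, (x k - c) ^ 2 := by
  have hn0 : (0 : ℝ) < n := by positivity
  have key : ∀ d : ℝ, ∑ k, (x k - d) ^ 2 = ∑ k, (x k) ^ 2 - 2 * d * ∑ k, x k + n * d ^ 2 := by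
    intro d
    simp only [sub_sq, Finset.sum_add_distrib, Finset.sum_sub_distrib, Finset.mul_sum]
    simp
    refine Finset.sum_congr rfl fun k _ => by ring
  rw [key, key]
  set s := ∑ k, x k
  have h : 0 ≤ n * (c - (n : ℝ)⁻¹ * s) ^ 2 := by positivity
  have e : (n : ℝ) * (c - (n : ℝ)⁻¹ * s) ^ 2
      = (-2 * c * s + n * c ^ 2) - (- 2 * ((n : ℝ)⁻¹ * s) * s + n * ((n : ℝ)⁻¹ * s) ^ 2) := by
    field_simp
    ring
  linarith

lemma rowNorm_periphery_le {n : ℕ} (hn : 2 ≤ n) (P : Matrix (Fin n) (Fin n) ℝ)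
    (hP : IsProbMatrix P) (j : Fin n) (hj : j ∈ peripheryER P) :
    rowNorm (P * centerH n) j ≤ pstar P := by
  obtain ⟨-, h0, -, hd⟩ := hP
  haveI : Nontrivial (Fin n) := Fin.nontrivial_iff_two_le.mpr hn
  obtain ⟨k0, hk0⟩ := exists_ne j
  have hj' : ∀ a b, a ≠ j → b ≠ j → P j a = P j b := by
    simpa [peripheryER] using hj
  refine le_trans ?_ (entry_le_pstar P j k0)
  unfold rowNorm
  refine Real.sqrt_le_iff.mpr ⟨h0 _ _, ?_⟩
  simp only [mul_centerH_apply]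
  refine (sum_sq_center_le hn (P j) (P j k0)).trans (le_of_eq ?_)
  rw [Finset.sum_eq_single j]
  · simp [hd]
  · intro b _ hb
    simp [hj' b k0 hb hk0]
  · simp

/-- deterministic separation of core and periphery scores under the
ER-type model after a small perturbation. -/
theorem er_score_separation
    (n : ℕ) (hn : 2 ≤ n)
    (P : Matrix (Fin n) (Fin n) ℝ) (hP : IsProbMatrix P)
    (hsig : pstar P < hSignal P)
    (Q : Matrix (Fin n) (Fin n) ℝ)
    (hQ : twoInf ((Q - P) * centerH n) < (hSignal P - pstar P) / 2) :
    ∀ i ∈ coreER P, ∀ j ∉ coreER P,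
      rowNorm (Q * centerH n) j < rowNorm (Q * centerH n) i := by
  intro i hi j hj
  have hj1 : j ∈ peripheryER P := by simpa [coreER] using hj
  have h1 := rowNorm_periphery_le hn P hP j hj1
  have h2 : hSignal P ≤ rowNorm (P * centerH n) i :=
    ciInf_le (f := fun i : {i // i ∈ coreER P} => rowNorm (P * centerH n) i.1)
      (Set.finite_range _).bddBelow ⟨i, hi⟩
  have h3 := rowNorm_le_twoInf ((Q - P) * centerH n) i
  have h4 := rowNorm_le_twoInf ((Q - P) * centerH n) j
  have h5 := rowNorm_add_le (P * centerH n) ((Q - P) * centerH n) j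
  have h6 := rowNorm_add_le (Q * centerH n) (-((Q - P) * centerH n)) i
  rw [rowNorm_neg] at h6
  have e5 : P * centerH n + (Q - P) * centerH n = Q * centerH n := by
    rw [Matrix.sub_mul]; abel
  have e6 : Q * centerH n + -((Q - P) * centerH n) = P * centerH n := by
    rw [Matrix.sub_mul]; abel
  rw [e5] at h5
  rw [e6] at h6
  linarith
end
end

section
/- Let P and Q be any n×n real matrices, and let D and D̂ be invertible diagonal n×n matrices. Then (1 − ‖D̂ D^{-1} − I_n‖₂) · ‖P D^{-1} − Q D̂^{-1}‖_{2,∞} ≤ ‖P − Q‖_{2,∞} · ‖D^{-1}‖₂ + ‖P D^{-1}‖_{2,∞} · ‖D̂ D^{-1} − I_n‖₂. -/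
open Matrix MeasureTheory ProbabilityTheory

noncomputable section

theorem rowNorm_eq_aux {n m : ℕ} (M : Matrix (Fin n) (Fin m) ℝ) (i : Fin n) :
    rowNorm M i = ‖(WithLp.toLp 2 (M i) : EuclideanSpace ℝ (Fin m))‖ := by
  rw [EuclideanSpace.norm_eq]
  simp [rowNorm]

open scoped Matrix.Norms.L2Operator in
theorem rowNorm_mul_aux {n : ℕ} (X Y : Matrix (Fin n) (Fin n) ℝ) (i : Fin n) :
    rowNorm (X * Y) i ≤ rowNorm X i * specNorm Y := by
  have h1 : specNorm Y = ‖Yᴴ‖ := by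
    rw [Matrix.l2_opNorm_conjTranspose, Matrix.l2_opNorm_def]; rfl
  rw [h1, rowNorm_eq_aux, rowNorm_eq_aux, mul_comm]
  have h2 := Matrix.l2_opNorm_mulVec Yᴴ (WithLp.toLp 2 (X i))
  convert h2 using 3
  ext j
  simp [Matrix.mul_apply, Matrix.mulVec, dotProduct, mul_comm]

theorem rowNorm_le_twoInf_aux {n : ℕ} (X : Matrix (Fin n) (Fin n) ℝ) (i : Fin n) :
    rowNorm X i ≤ twoInf X :=
  le_ciSup (f := rowNorm X) (Set.finite_range _).bddAbove i

theorem specNorm_nonneg_aux {n : ℕ} (X : Matrix (Fin n) (Fin n) ℝ) : 0 ≤ specNorm X :=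
  norm_nonneg _

/-- degree-corrected two-to-infinity perturbation inequality. -/
theorem degree_corrected_two_inf_bound
    (n : ℕ) (hn : 1 ≤ n)
    (P Q : Matrix (Fin n) (Fin n) ℝ)
    (d dh : Fin n → ℝ) (hd : ∀ i, d i ≠ 0) (hdh : ∀ i, dh i ≠ 0) :
    (1 - specNorm (Matrix.diagonal dh * degInv d - 1)) *
        twoInf (P * degInv d - Q * degInv dh) ≤
      twoInf (P - Q) * specNorm (degInv d)
        + twoInf (P * degInv d) * specNorm (Matrix.diagonal dh * degInv d - 1) := by
  have : Nonempty (Fin n) := ⟨⟨0, hn⟩⟩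
  set E := Matrix.diagonal dh * degInv d - 1 with hE
  set X := P * degInv d - Q * degInv dh with hX
  have hinv : degInv dh * Matrix.diagonal dh = 1 := by
    simp [degInv, hdh]
  have key : X = (P - Q) * degInv d + P * degInv d * E - X * E := by
    have h1 : Q * degInv dh * E = Q * degInv d - Q * degInv dh := by
      rw [hE, mul_sub, mul_one, ← mul_assoc, mul_assoc Q, hinv, mul_one]
    have h2 : X * E = P * degInv d * E - Q * degInv dh * E := by rw [hX, sub_mul]
    rw [h2, h1, hX, sub_mul]
    abel
  have row : ∀ i, rowNorm X i ≤ twoInf (P - Q) * specNorm (degInv d)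
      + twoInf (P * degInv d) * specNorm E + twoInf X * specNorm E := by
    intro i
    have ha := (rowNorm_mul_aux (P - Q) (degInv d) i).trans
      (mul_le_mul_of_nonneg_right (rowNorm_le_twoInf_aux _ i) (specNorm_nonneg_aux _))
    have hb := (rowNorm_mul_aux (P * degInv d) E i).trans
      (mul_le_mul_of_nonneg_right (rowNorm_le_twoInf_aux _ i) (specNorm_nonneg_aux _))
    have hc := (rowNorm_mul_aux X E i).trans
      (mul_le_mul_of_nonneg_right (rowNorm_le_twoInf_aux _ i) (specNorm_nonneg_aux _))
    have ht : rowNorm X i ≤ rowNorm ((P - Q) * degInv d) i + rowNorm (P * degInv d * E) i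
        + rowNorm (X * E) i := by
      have hk : (WithLp.toLp 2 (X i) : EuclideanSpace ℝ (Fin n)) =
          WithLp.toLp 2 (((P - Q) * degInv d) i) + WithLp.toLp 2 ((P * degInv d * E) i)
            - WithLp.toLp 2 ((X * E) i) := by
        ext j
        exact congrFun (congrFun key i) j
      simp only [rowNorm_eq_aux]
      rw [hk]
      exact (norm_sub_le _ _).trans (add_le_add_left (norm_add_le _ _) _)
    linarith
  have hsup : twoInf X ≤ _ := ciSup_le row
  linarith
end
end

section
/- Let P and A be symmetric n×n real matrices, let λ₁,…,λ_n be the eigenvalues of P ordered so that |λ₁| ≥ … ≥ |λ_n|, let r ∈ [n−1], and let P̂ be the rank-r spectral truncation of A (retaining the r eigenvalues of A largest in absolute value, a best rank-r approximation of A in spectral norm). Then: (i) ‖A − P̂‖₂ ≤ ‖A − P‖₂ + |λ_{r+1}|; (ii) ‖P − P̂‖₂ ≤ 2‖A − P‖₂ + |λ_{r+1}|; and (iii) for the centering matrix H, ‖(P − P̂)H‖_F² ≤ (rank(P) + r) · (2‖A − P‖₂ + |λ_{r+1}|)². -/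
open Matrix MeasureTheory ProbabilityTheory

noncomputable section

open scoped Matrix.Norms.L2Operator in
theorem aux_specNorm_eq {n : ℕ} (M : Matrix (Fin n) (Fin n) ℝ) : specNorm M = ‖M‖ := rfl

theorem aux_en_sq {n : ℕ} (x : Fin n → ℝ) : ‖WithLp.toLp 2 x‖ ^ 2 = ∑ i, x i ^ 2 := by
  rw [EuclideanSpace.norm_sq_eq]; simp

theorem aux_mulVec_le {n : ℕ} (M : Matrix (Fin n) (Fin n) ℝ) (x : Fin n → ℝ) :
    ‖WithLp.toLp 2 (M *ᵥ x)‖ ≤ specNorm M * ‖WithLp.toLp 2 x‖ :=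
  ContinuousLinearMap.le_opNorm (LinearMap.toContinuousLinearMap (Matrix.toEuclideanLin M))
    (WithLp.toLp 2 x)

theorem aux_orth_norm {n : ℕ} (W : Matrix (Fin n) (Fin n) ℝ) (h : Wᵀ * W = 1) (x : Fin n → ℝ) :
    ‖WithLp.toLp 2 (W *ᵥ x)‖ = ‖WithLp.toLp 2 x‖ := by
  have key : ‖WithLp.toLp 2 (W *ᵥ x)‖ ^ 2 = ‖WithLp.toLp 2 x‖ ^ 2 := by
    rw [aux_en_sq, aux_en_sq]
    have h1 : (W *ᵥ x) ⬝ᵥ (W *ᵥ x) = x ⬝ᵥ x := by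
      rw [Matrix.dotProduct_mulVec, Matrix.vecMul_mulVec, ← Matrix.dotProduct_mulVec, h, Matrix.one_mulVec]
    simpa [dotProduct, sq] using h1
  exact (sq_eq_sq₀ (norm_nonneg _) (norm_nonneg _)).1 key

theorem aux_spec_le {n : ℕ} (M : Matrix (Fin n) (Fin n) ℝ) (c : ℝ) (hc : 0 ≤ c)
    (h : ∀ x : Fin n → ℝ, ‖WithLp.toLp 2 (M *ᵥ x)‖ ≤ c * ‖WithLp.toLp 2 x‖) :
    specNorm M ≤ c :=
  ContinuousLinearMap.opNorm_le_bound _ hc fun x => h x.ofLp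

theorem aux_diag_le {n : ℕ} (d y : Fin n → ℝ) (c : ℝ) (hc : 0 ≤ c)
    (h : ∀ i, y i = 0 ∨ |d i| ≤ c) :
    ‖WithLp.toLp 2 (Matrix.diagonal d *ᵥ y)‖ ≤ c * ‖WithLp.toLp 2 y‖ := by
  refine (sq_le_sq₀ (by positivity) (by positivity)).1 ?_
  rw [mul_pow, aux_en_sq, aux_en_sq, Finset.mul_sum]
  refine Finset.sum_le_sum fun i _ => ?_
  rw [Matrix.mulVec_diagonal, mul_pow]
  rcases h i with h | h
  · simp [h]
  · have : d i ^ 2 ≤ c ^ 2 := sq_le_sq' (by linarith [neg_abs_le (d i)]) ((le_abs_self _).trans h)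
    gcongr

theorem aux_diag_ge {n : ℕ} (d y : Fin n → ℝ) (c : ℝ) (hc : 0 ≤ c)
    (h : ∀ i, y i = 0 ∨ c ≤ |d i|) :
    c * ‖WithLp.toLp 2 y‖ ≤ ‖WithLp.toLp 2 (Matrix.diagonal d *ᵥ y)‖ := by
  refine (sq_le_sq₀ (by positivity) (by positivity)).1 ?_
  rw [mul_pow, aux_en_sq, aux_en_sq, Finset.mul_sum]
  refine Finset.sum_le_sum fun i _ => ?_
  rw [Matrix.mulVec_diagonal, mul_pow]
  rcases h i with h | h
  · simp [h]
  · have : c ^ 2 ≤ d i ^ 2 := by rw [← sq_abs (d i)]; gcongr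
    gcongr

theorem aux_weyl {n : ℕ} (P A V W : Matrix (Fin n) (Fin n) ℝ) (lam mu : Fin n → ℝ)
    (hP : IsEigenDecomp P V lam) (hA : IsEigenDecomp A W mu) (r : Fin n) :
    |mu r| ≤ specNorm (A - P) + |lam r| := by
  obtain ⟨hV, hPe, hl⟩ := hP
  obtain ⟨hW, hAe, hm⟩ := hA
  have hV' : Vᵀ * V = 1 := mul_eq_one_comm.1 hV
  have hW' : Wᵀ * W = 1 := mul_eq_one_comm.1 hW
  let K : Matrix (Fin n) (Fin n) ℝ := Matrix.of fun i j =>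
    if i < r then Vᵀ i j else if r < i then Wᵀ i j else 0
  have hdet : K.det = 0 := Matrix.det_eq_zero_of_row_eq_zero r (by intro j; simp [K])
  obtain ⟨v, hv0, hv⟩ := Matrix.exists_mulVec_eq_zero_iff.2 hdet
  have hvV : ∀ i, i < r → (Vᵀ *ᵥ v) i = 0 := by
    intro i hi
    have := congrFun hv i
    simpa [K, Matrix.mulVec, dotProduct, hi] using this
  have hvW : ∀ i, r < i → (Wᵀ *ᵥ v) i = 0 := by
    intro i hi
    have := congrFun hv i
    simpa [K, Matrix.mulVec, dotProduct, hi, hi.not_gt] using this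
  have hpos : 0 < ‖WithLp.toLp 2 v‖ := by
    rw [norm_pos_iff]; intro h; apply hv0
    simpa using h
  have h1 : ‖WithLp.toLp 2 (P *ᵥ v)‖ ≤ |lam r| * ‖WithLp.toLp 2 v‖ := by
    rw [hPe, Matrix.mul_assoc, ← Matrix.mulVec_mulVec, ← Matrix.mulVec_mulVec,
      aux_orth_norm V hV', ← aux_orth_norm Vᵀ (by simpa using hV) v]
    apply aux_diag_le _ _ _ (abs_nonneg _)
    intro i
    rcases lt_or_ge i r with h | h
    · exact Or.inl (hvV i h)
    · exact Or.inr (hl _ _ h)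
  have h2 : |mu r| * ‖WithLp.toLp 2 v‖ ≤ ‖WithLp.toLp 2 (A *ᵥ v)‖ := by
    rw [hAe, Matrix.mul_assoc, ← Matrix.mulVec_mulVec, ← Matrix.mulVec_mulVec,
      aux_orth_norm W hW', ← aux_orth_norm Wᵀ (by simpa using hW) v]
    apply aux_diag_ge _ _ _ (abs_nonneg _)
    intro i
    rcases lt_or_ge r i with h | h
    · exact Or.inl (hvW i h)
    · exact Or.inr (hm _ _ h)
  have h3 := aux_mulVec_le (A - P) v
  have h4 : ‖WithLp.toLp 2 (A *ᵥ v)‖ ≤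
      ‖WithLp.toLp 2 ((A - P) *ᵥ v)‖ + ‖WithLp.toLp 2 (P *ᵥ v)‖ := by
    have : WithLp.toLp 2 (A *ᵥ v) = WithLp.toLp 2 ((A - P) *ᵥ v) + WithLp.toLp 2 (P *ᵥ v) := by
      rw [← WithLp.toLp_add, ← Matrix.add_mulVec, sub_add_cancel]
    rw [this]; exact norm_add_le _ _
  refine le_of_mul_le_mul_right ?_ hpos
  linarith

theorem aux_frob {n : ℕ} (N : Matrix (Fin n) (Fin n) ℝ) :
    frobNorm N ^ 2 ≤ N.rank * specNorm N ^ 2 := by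
  have hH : (Nᴴ * N).IsHermitian := Matrix.isHermitian_conjTranspose_mul_self N
  have h1 : frobNorm N ^ 2 = ∑ i, hH.eigenvalues i := by
    have := hH.trace_eq_sum_eigenvalues
    simp only [RCLike.ofReal_real_eq_id, id] at this
    rw [← this, frobNorm, Real.sq_sqrt (by positivity), Finset.sum_comm]
    simp [Matrix.trace, Matrix.mul_apply, sq]
  have h2 : ∀ i, hH.eigenvalues i ≤ specNorm N ^ 2 := by
    intro i
    set v := hH.eigenvectorBasis i with hvdef
    have hv : ‖v‖ = 1 := hH.eigenvectorBasis.orthonormal.1 i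
    have e := hH.mulVec_eigenvectorBasis i
    have a : specNorm (Nᴴ * N) = specNorm N * specNorm N :=
      Matrix.l2_opNorm_conjTranspose_mul_self N
    have b := aux_mulVec_le (Nᴴ * N) v.ofLp
    rw [e] at b
    rw [a, ← sq, WithLp.toLp_smul, norm_smul] at b
    simp only [WithLp.toLp_ofLp, ← hvdef, hv, mul_one] at b
    exact (le_abs_self _).trans b
  rw [h1, ← Matrix.rank_conjTranspose_mul_self N, hH.rank_eq_card_non_zero_eigs, Fintype.card_subtype,
    ← Finset.sum_filter_ne_zero, ← nsmul_eq_mul]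
  exact Finset.sum_le_card_nsmul _ _ _ fun i _ => h2 i

theorem aux_center {n : ℕ} (hn : 2 ≤ n) : specNorm (centerH n) ≤ 1 := by
  have h : (centerH n)ᴴ * centerH n = centerH n := by
    have hn0 : (n : ℝ) ≠ 0 := by positivity
    have hc : (centerH n)ᴴ = centerH n := by
      ext i j
      simp [centerH, Matrix.one_apply, eq_comm]
    have hJ : (Matrix.of fun _ _ => (1 : ℝ) : Matrix (Fin n) (Fin n) ℝ) *
        (Matrix.of fun _ _ => (1 : ℝ)) = (n : ℝ) • Matrix.of fun _ _ => (1 : ℝ) := by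
      ext i j
      simp [Matrix.mul_apply]
    rw [hc, centerH, sub_mul, mul_sub, mul_sub, Matrix.smul_mul, Matrix.mul_smul, Matrix.mul_smul, Matrix.smul_mul, hJ]
    simp [smul_smul, hn0]
  have a : specNorm ((centerH n)ᴴ * centerH n) = specNorm (centerH n) * specNorm (centerH n) :=
    Matrix.l2_opNorm_conjTranspose_mul_self _
  rw [h] at a
  have : 0 ≤ specNorm (centerH n) := norm_nonneg _
  nlinarith

theorem aux_rank_sub {n : ℕ} (P Q : Matrix (Fin n) (Fin n) ℝ) :
    (P - Q).rank ≤ P.rank + Q.rank := by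
  refine le_trans (Submodule.finrank_mono ?_) (Submodule.finrank_add_le_finrank_add_finrank _ _)
  rintro _ ⟨x, rfl⟩
  rw [Matrix.mulVecLin_apply, Matrix.sub_mulVec]
  exact Submodule.sub_mem_sup ⟨x, rfl⟩ ⟨x, rfl⟩

theorem aux_rank_trunc {n r : ℕ} (W : Matrix (Fin n) (Fin n) ℝ) (mu : Fin n → ℝ) (hrn : r < n) :
    (W * Matrix.diagonal (fun i : Fin n => if (i : ℕ) < r then mu i else 0) * Wᵀ).rank ≤ r := by
  classical
  refine (Matrix.rank_mul_le_left _ _).trans ((Matrix.rank_mul_le_right _ _).trans ?_)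
  rw [Matrix.rank_diagonal, Fintype.card_subtype]
  calc _ ≤ (Finset.univ.filter fun i : Fin n => (i : ℕ) < r).card := by
        apply Finset.card_le_card
        intro i hi
        simp at hi ⊢
        exact hi.1
    _ ≤ (Finset.range r).card := by
        apply Finset.card_le_card_of_injOn (fun i : Fin n => (i : ℕ))
        · intro i hi; simpa using hi
        · exact Fin.val_injective.injOn
    _ = r := Finset.card_range r

open scoped Matrix.Norms.L2Operator in
theorem aux_spec_sub {n : ℕ} (M N : Matrix (Fin n) (Fin n) ℝ) :
    specNorm (M - N) ≤ specNorm M + specNorm N := by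
  simp only [aux_specNorm_eq]
  exact norm_sub_le M N

/-- basic inequalities for the rank-`r` spectral truncation. -/
theorem spectral_truncation_bounds
    (n : ℕ) (hn : 2 ≤ n)
    (P A : Matrix (Fin n) (Fin n) ℝ) (hPsymm : P.IsSymm) (hAsymm : A.IsSymm)
    (V : Matrix (Fin n) (Fin n) ℝ) (lam : Fin n → ℝ) (hVlam : IsEigenDecomp P V lam)
    (r : ℕ) (hr1 : 1 ≤ r) (hrn : r < n)
    (Phat : Matrix (Fin n) (Fin n) ℝ) (hPhat : IsSpecTrunc r A Phat) :
    specNorm (A - Phat) ≤ specNorm (A - P) + |lam ⟨r, hrn⟩| ∧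
    specNorm (P - Phat) ≤ 2 * specNorm (A - P) + |lam ⟨r, hrn⟩| ∧
    frobNorm ((P - Phat) * centerH n) ^ 2 ≤
      ((P.rank : ℝ) + r) * (2 * specNorm (A - P) + |lam ⟨r, hrn⟩|) ^ 2 := by
  obtain ⟨W, mu, hA, hT⟩ := hPhat
  have hnn : ∀ M : Matrix (Fin n) (Fin n) ℝ, 0 ≤ specNorm M := fun M => norm_nonneg _
  have h1 : specNorm (A - Phat) ≤ specNorm (A - P) + |lam ⟨r, hrn⟩| := by
    refine le_trans ?_ (aux_weyl P A V W lam mu hVlam hA ⟨r, hrn⟩)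
    obtain ⟨hW, hAe, hm⟩ := hA
    have hW' : Wᵀ * W = 1 := mul_eq_one_comm.1 hW
    have e : A - Phat = W * (Matrix.diagonal
        (fun i : Fin n => mu i - if (i : ℕ) < r then mu i else 0) * Wᵀ) := by
      rw [hT, ← Matrix.diagonal_sub, Matrix.sub_mul, Matrix.mul_sub, ← Matrix.mul_assoc,
        ← Matrix.mul_assoc, ← hAe]
    refine aux_spec_le _ _ (abs_nonneg _) fun x => ?_
    rw [e, ← Matrix.mulVec_mulVec, ← Matrix.mulVec_mulVec, aux_orth_norm W hW',
      ← aux_orth_norm Wᵀ (by simpa using hW) x]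
    apply aux_diag_le _ _ _ (abs_nonneg _)
    intro i
    right
    by_cases h : (i : ℕ) < r
    · simp [h]
    · simp only [h, if_false, sub_zero]
      exact hm _ _ (by simpa [Fin.le_def] using h)
  have h2 : specNorm (P - Phat) ≤ 2 * specNorm (A - P) + |lam ⟨r, hrn⟩| := by
    have e : P - Phat = (A - Phat) - (A - P) := by abel
    have h3 : specNorm (P - Phat) ≤ specNorm (A - Phat) + specNorm (A - P) := by
      rw [e]
      exact aux_spec_sub _ _
    linarith
  refine ⟨h1, h2, (aux_frob _).trans ?_⟩
  have hrk : (((P - Phat) * centerH n).rank : ℝ) ≤ (P.rank : ℝ) + r := by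
    have := (Matrix.rank_mul_le_left (P - Phat) (centerH n)).trans (aux_rank_sub P Phat)
    have h4 : Phat.rank ≤ r := hT ▸ aux_rank_trunc W mu hrn
    exact_mod_cast this.trans (by omega)
  have hs : specNorm ((P - Phat) * centerH n) ≤ 2 * specNorm (A - P) + |lam ⟨r, hrn⟩| := by
    have h5 : specNorm ((P - Phat) * centerH n) ≤ specNorm (P - Phat) * specNorm (centerH n) :=
      Matrix.l2_opNorm_mul _ _
    exact (h5.trans (mul_le_of_le_one_right (hnn _) (aux_center hn))).trans h2
  have := hnn ((P - Phat) * centerH n)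
  gcongr

end
end

section
/- Let K ≥ 2, n = K·m for m ≥ 1, z : [n] → [K] an assignment with each block of size m, θ : [n] → (0,∞) with Σ_{i : z_i = k} θ_i = m for every k ∈ [K], B a symmetric K×K nonnegative matrix with B_{kK} = B_{Kk} = 1 for all k ∈ [K] and Σ_{k'=1}^{K} B_{k k'} = K for all k ∈ [K−1], and ρ > 0. Define P by P_ij = ρ θ_i θ_j B_{z_i z_j} (including the diagonal). Then for every i, the expected degree satisfies d_i := Σ_{j=1}^{n} P_ij = n ρ θ_i, and for every i with z_i = K and every j, P_ij = d_i d_j / Σ_{k=1}^{n} d_k. In particular, every node in block K is a periphery node of the configuration-type core–periphery structure. -/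
open Matrix MeasureTheory ProbabilityTheory

noncomputable section

/-- in a DC-SBM whose last block has a constant `B`-row of ones and whose other
rows sum to `K`, every node of the last block is a configuration-type periphery node. -/
theorem dcsbm_periphery
    (K m : ℕ) (hK : 2 ≤ K) (hm : 1 ≤ m)
    (n : ℕ) (hn : n = K * m)
    (z : Fin n → Fin K)
    (hblock : ∀ k : Fin K, (Finset.univ.filter fun i => z i = k).card = m)
    (θ : Fin n → ℝ) (hθ : ∀ i, 0 < θ i)
    (hθsum : ∀ k : Fin K, ∑ i ∈ Finset.univ.filter (fun i => z i = k), θ i = (m : ℝ))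
    (B : Matrix (Fin K) (Fin K) ℝ) (hBsymm : B.IsSymm) (hBnonneg : ∀ k k', 0 ≤ B k k')
    (hBlast : ∀ k : Fin K, B k ⟨K - 1, by omega⟩ = 1 ∧ B ⟨K - 1, by omega⟩ k = 1)
    (hBrow : ∀ k : Fin K, (k : ℕ) < K - 1 → ∑ k', B k k' = (K : ℝ))
    (ρ : ℝ) (hρ : 0 < ρ)
    (P : Matrix (Fin n) (Fin n) ℝ)
    (hPdef : ∀ i j, P i j = ρ * θ i * θ j * B (z i) (z j)) :
    (∀ i, deg P i = n * ρ * θ i) ∧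
      (∀ i, z i = (⟨K - 1, by omega⟩ : Fin K) → ∀ j,
        P i j = deg P i * deg P j / ∑ k, deg P k) ∧
      (∀ i, z i = (⟨K - 1, by omega⟩ : Fin K) → i ∈ peripheryConfig P) := by
  have hfib : ∀ f : Fin K → ℝ, ∑ j, θ j * f (z j) = m * ∑ k, f k := by
    intro f
    rw [← Finset.sum_fiberwise Finset.univ z, Finset.mul_sum]
    refine Finset.sum_congr rfl fun k _ => ?_
    rw [← hθsum k, Finset.sum_mul]
    refine Finset.sum_congr rfl fun j hj => ?_
    rw [(Finset.mem_filter.mp hj).2]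
  have hrow : ∀ k : Fin K, ∑ k', B k k' = (K : ℝ) := by
    intro k
    by_cases h : (k : ℕ) < K - 1
    · exact hBrow k h
    · have hk : k = ⟨K - 1, by omega⟩ := by
        apply Fin.ext
        have := k.2
        simp only
        omega
      rw [hk, Finset.sum_congr rfl fun k' _ => (hBlast k').2]
      simp
  have hnR : (n : ℝ) = K * m := by rw [hn]; push_cast; rfl
  have hn0 : (n : ℝ) ≠ 0 := by
    have : 0 < K * m := Nat.mul_pos (by omega) (by omega)
    rw [hn]
    exact_mod_cast this.ne'
  have hdeg : ∀ i, deg P i = n * ρ * θ i := by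
    intro i
    have h := hfib (B (z i))
    rw [hrow] at h
    calc deg P i = ∑ j, ρ * θ i * (θ j * B (z i) (z j)) :=
          Finset.sum_congr rfl fun j _ => by rw [hPdef]; ring
      _ = ρ * θ i * (m * K) := by rw [← Finset.mul_sum, h]
      _ = n * ρ * θ i := by rw [hnR]; ring
  have htot : ∑ k, deg P k = n * ρ * n := by
    have h := hfib fun _ => 1
    simp only [mul_one, Finset.sum_const, Finset.card_univ, Fintype.card_fin, nsmul_eq_mul] at h
    rw [Finset.sum_congr rfl fun k _ => hdeg k, ← Finset.mul_sum, h]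
    rw [hnR]; ring
  have hper : ∀ i, z i = (⟨K - 1, by omega⟩ : Fin K) → ∀ j,
      P i j = deg P i * deg P j / ∑ k, deg P k := by
    intro i hi j
    rw [htot, hdeg, hdeg, hPdef, hi, (hBlast (z j)).2]
    have := hρ.ne'
    field_simp
  refine ⟨hdeg, hper, fun i hi => ?_⟩
  simp only [peripheryConfig, Finset.mem_filter, Finset.mem_univ, true_and]
  exact fun j _ => hper i hi j
end
end

section
/- Let N_C, N_P ≥ 1 and n = N_C + N_P. Let P^C be a symmetric N_C×N_C nonnegative matrix with positive row sums θ_i = Σ_{j=1}^{N_C} P^C_{ij} for i ∈ [N_C], let θ_i > 0 be arbitrary for N_C < i ≤ n, and set s = Σ_{i=1}^{N_C} θ_i and T = Σ_{i=1}^{n} θ_i. Define the symmetric n×n matrix P by P_ij = P^C_{ij} when i, j ≤ N_C, and P_ij = θ_i θ_j / s when i > N_C or j > N_C. Then for every i ∈ [n], d_i := Σ_{j=1}^{n} P_ij = θ_i T / s, and for every i > N_C and every j, P_ij = d_i d_j / Σ_{k=1}^{n} d_k. In particular, every node i > N_C is a periphery node of the configuration-type core–periphery structure. -/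
open Matrix MeasureTheory ProbabilityTheory

noncomputable section

/-- filling in a configuration-type periphery around an arbitrary core makes
every added node a periphery node. -/
theorem config_periphery_construction
    (NC NP : ℕ) (hNC : 1 ≤ NC) (hNP : 1 ≤ NP)
    (n : ℕ) (hn : n = NC + NP)
    (PC : Matrix (Fin n) (Fin n) ℝ)
    (hsymm : ∀ i j, PC i j = PC j i) (hnn : ∀ i j, 0 ≤ PC i j)
    (θ : Fin n → ℝ) (hθpos : ∀ i, 0 < θ i)
    (hθcore : ∀ i : Fin n, (i : ℕ) < NC →
      θ i = ∑ j ∈ Finset.univ.filter (fun j : Fin n => (j : ℕ) < NC), PC i j)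
    (s T : ℝ)
    (hs : s = ∑ i ∈ Finset.univ.filter (fun i : Fin n => (i : ℕ) < NC), θ i)
    (hT : T = ∑ i, θ i)
    (P : Matrix (Fin n) (Fin n) ℝ)
    (hPdef : ∀ i j : Fin n,
      P i j = if (i : ℕ) < NC ∧ (j : ℕ) < NC then PC i j else θ i * θ j / s) :
    (∀ i, deg P i = θ i * T / s) ∧
      (∀ i : Fin n, NC ≤ (i : ℕ) → ∀ j, P i j = deg P i * deg P j / ∑ k, deg P k) ∧
      (∀ i : Fin n, NC ≤ (i : ℕ) → i ∈ peripheryConfig P) := by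
  have hspos : 0 < s := by
    rw [hs]
    refine Finset.sum_pos (fun i _ => hθpos i) ⟨⟨0, by omega⟩, ?_⟩
    simp only [Finset.mem_filter, Finset.mem_univ, true_and]
    omega
  have hTpos : 0 < T := by
    rw [hT]
    exact Finset.sum_pos (fun i _ => hθpos i) ⟨⟨0, by omega⟩, Finset.mem_univ _⟩
  have hsplit : T = s + ∑ i ∈ Finset.univ.filter (fun i : Fin n => ¬ (i : ℕ) < NC), θ i := by
    rw [hT, hs, Finset.sum_filter_add_sum_filter_not]
  have hdeg : ∀ i, deg P i = θ i * T / s := by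
    intro i
    unfold deg
    by_cases hi : (i : ℕ) < NC
    · rw [← Finset.sum_filter_add_sum_filter_not Finset.univ (fun j : Fin n => (j : ℕ) < NC)]
      have h1 : ∑ j ∈ Finset.univ.filter (fun j : Fin n => (j : ℕ) < NC), P i j = θ i := by
        rw [hθcore i hi]
        refine Finset.sum_congr rfl fun j hj => ?_
        rw [hPdef, if_pos ⟨hi, (Finset.mem_filter.mp hj).2⟩]
      have h2 : ∑ j ∈ Finset.univ.filter (fun j : Fin n => ¬ (j : ℕ) < NC), P i j
          = θ i * (∑ j ∈ Finset.univ.filter (fun j : Fin n => ¬ (j : ℕ) < NC), θ j) / s := by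
        rw [Finset.mul_sum, Finset.sum_div]
        refine Finset.sum_congr rfl fun j hj => ?_
        rw [hPdef, if_neg (fun h => (Finset.mem_filter.mp hj).2 h.2)]
      rw [h1, h2, hsplit]
      field_simp
    · rw [hT, Finset.mul_sum, Finset.sum_div]
      refine Finset.sum_congr rfl fun j _ => ?_
      rw [hPdef, if_neg (fun h => hi h.1)]
  have hsum : ∑ k, deg P k = T * T / s := by
    simp only [hdeg]
    rw [← Finset.sum_div, ← Finset.sum_mul, ← hT]
  have hper : ∀ i : Fin n, NC ≤ (i : ℕ) → ∀ j, P i j = deg P i * deg P j / ∑ k, deg P k := by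
    intro i hi j
    rw [hsum, hdeg, hdeg, hPdef, if_neg (fun h => absurd h.1 (not_lt.mpr hi))]
    field_simp
  refine ⟨hdeg, hper, fun i hi => ?_⟩
  unfold peripheryConfig
  simp only [Finset.mem_filter, Finset.mem_univ, true_and]
  exact fun j _ => hper i hi j
end
end

section
/- Let K ≥ 2 and β ∈ (0,1] be fixed, let B be a symmetric K×K matrix with entries in [0,1] such that the last row is constant (B_{Kk} = B_{KK'} for all k, k') and such that for every k ∈ [K−1] the row B_{k,*} is not constant. Then there exists a constant c > 0 (depending only on K, β and B) such that for every n, every p* ∈ (0,1], and every block assignment z : [n] → [K] with every block of size at least βn/K, the matrix P = p*·Z B Zᵗ (where Z is the n×K membership matrix, Z_{ik} = 1 iff z_i = k; the diagonal is included) satisfies, for every node i with z_i ∈ [K−1]: c · p* · √n ≤ ‖P_{i,*} H‖₂ ≤ p* · √n. In particular h(n) := min over such nodes of ‖P_{i,*}H‖₂ is of order p*√n. -/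
open Matrix MeasureTheory ProbabilityTheory

noncomputable section

/-- under a SBM whose non-periphery `B`-rows are non-constant, the core scores
`‖P_{i,*}H‖₂` are of order `p*√n`. -/
theorem sbm_signal_order
    (K : ℕ) (hK : 2 ≤ K) (β : ℝ) (hβ0 : 0 < β) (hβ1 : β ≤ 1)
    (B : Matrix (Fin K) (Fin K) ℝ) (hBsymm : B.IsSymm)
    (hB01 : ∀ k k', 0 ≤ B k k' ∧ B k k' ≤ 1)
    (hlastconst : ∀ k k' : Fin K, B ⟨K - 1, by omega⟩ k = B ⟨K - 1, by omega⟩ k')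
    (hnonconst : ∀ k : Fin K, (k : ℕ) < K - 1 → ∃ k' k'' : Fin K, B k k' ≠ B k k'') :
    ∃ c : ℝ, 0 < c ∧
      ∀ (n : ℕ) (hn : 2 ≤ n) (p : ℝ) (hp0 : 0 < p) (hp1 : p ≤ 1)
        (z : Fin n → Fin K)
        (hblocks : ∀ k : Fin K,
          β * n / K ≤ (((Finset.univ.filter fun i => z i = k).card : ℕ) : ℝ))
        (Z : Matrix (Fin n) (Fin K) ℝ)
        (hZ : ∀ i k, Z i k = if z i = k then 1 else 0)
        (P : Matrix (Fin n) (Fin n) ℝ) (hP : P = p • (Z * B * Zᵀ)),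
        ∀ i : Fin n, (z i : ℕ) < K - 1 →
          c * p * Real.sqrt n ≤ rowNorm (P * centerH n) i ∧
            rowNorm (P * centerH n) i ≤ p * Real.sqrt n := by
  classical
  have hδ : ∀ k : Fin K, ∃ d : ℝ, 0 < d ∧ ((k : ℕ) < K - 1 →
      ∃ k' k'' : Fin K, k' ≠ k'' ∧ d ≤ (B k k' - B k k'') ^ 2) := by
    intro k
    by_cases hk : (k : ℕ) < K - 1
    · obtain ⟨a, b, hab⟩ := hnonconst k hk
      refine ⟨(B k a - B k b) ^ 2, ?_, fun _ => ⟨a, b, ?_, le_rfl⟩⟩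
      · have : B k a - B k b ≠ 0 := sub_ne_zero.mpr hab
        positivity
      · rintro rfl
        exact hab rfl
    · exact ⟨1, one_pos, fun h => absurd h hk⟩
  choose d hd0 hd using hδ
  have hne : (Finset.univ : Finset (Fin K)).Nonempty := ⟨⟨0, by omega⟩, Finset.mem_univ _⟩
  obtain ⟨k0, -, hk0⟩ := Finset.exists_min_image Finset.univ d hne
  have hKpos : (0 : ℝ) < K := by
    have : 0 < K := by omega
    exact_mod_cast this
  have hd00 := hd0 k0
  refine ⟨Real.sqrt (β / K * (d k0 / 2)), Real.sqrt_pos.mpr (by positivity), ?_⟩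
  intro n hn p hp0 hp1 z hblocks Z hZ P hP i hi
  have hnpos : (0 : ℝ) < n := by
    have : 0 < n := by omega
    exact_mod_cast this
  have hPij : ∀ j, P i j = p * B (z i) (z j) := by
    intro j
    rw [hP]
    simp [Matrix.mul_apply, hZ]
  obtain ⟨m, hm⟩ : ∃ m : ℝ, m = (n : ℝ)⁻¹ * ∑ j, B (z i) (z j) := ⟨_, rfl⟩
  have hm0 : 0 ≤ m := by
    rw [hm]
    exact mul_nonneg (by positivity) (Finset.sum_nonneg fun j _ => (hB01 _ _).1)
  have hm1 : m ≤ 1 := by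
    have h1 : ∑ j, B (z i) (z j) ≤ ∑ _j : Fin n, (1 : ℝ) :=
      Finset.sum_le_sum fun j _ => (hB01 _ _).2
    simp only [Finset.sum_const, Finset.card_univ, Fintype.card_fin, nsmul_eq_mul, mul_one] at h1
    rw [hm, inv_mul_le_iff₀ hnpos]
    linarith
  have hPH : ∀ j, (P * centerH n) i j = p * (B (z i) (z j) - m) := by
    intro j
    have : (P * centerH n) i j = P i j - (n : ℝ)⁻¹ * ∑ l, P i l := by
      unfold centerH
      rw [Matrix.mul_sub, Matrix.mul_one, Matrix.sub_apply, Matrix.mul_smul, Matrix.smul_apply,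
        Matrix.mul_apply]
      simp
    rw [this, hm]
    simp only [hPij, ← Finset.mul_sum]
    ring
  have hsum : ∑ j, ((P * centerH n) i j) ^ 2 = p ^ 2 * ∑ j, (B (z i) (z j) - m) ^ 2 := by
    rw [Finset.mul_sum]
    refine Finset.sum_congr rfl fun j _ => ?_
    rw [hPH]
    ring
  unfold rowNorm
  rw [hsum]
  constructor
  · apply Real.le_sqrt_of_sq_le
    rw [mul_pow, mul_pow, Real.sq_sqrt (by positivity), Real.sq_sqrt (by positivity)]
    obtain ⟨a, b, hab, hdab⟩ := hd (z i) hi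
    have hmin := hk0 (z i) (Finset.mem_univ _)
    have hblk : ∀ k, ∑ j ∈ Finset.univ.filter (fun j => z j = k), (B (z i) (z j) - m) ^ 2
        = ((Finset.univ.filter fun j => z j = k).card : ℝ) * (B (z i) k - m) ^ 2 := by
      intro k
      rw [Finset.sum_congr rfl (g := fun _ => (B (z i) k - m) ^ 2)]
      · simp
      · intro j hj
        rw [(Finset.mem_filter.mp hj).2]
    have hdisj : Disjoint (Finset.univ.filter fun j => z j = a)
        (Finset.univ.filter fun j => z j = b) := by
      rw [Finset.disjoint_filter]
      intro j _ h1 h2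
      exact hab (h1.symm.trans h2)
    have hle : ∑ j ∈ (Finset.univ.filter fun j => z j = a) ∪
        (Finset.univ.filter fun j => z j = b), (B (z i) (z j) - m) ^ 2
        ≤ ∑ j, (B (z i) (z j) - m) ^ 2 :=
      Finset.sum_le_sum_of_subset_of_nonneg (Finset.subset_univ _)
        fun _ _ _ => sq_nonneg _
    rw [Finset.sum_union hdisj, hblk, hblk] at hle
    have h1 := mul_le_mul_of_nonneg_right (hblocks a) (sq_nonneg (B (z i) a - m))
    have h2 := mul_le_mul_of_nonneg_right (hblocks b) (sq_nonneg (B (z i) b - m))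
    have h3 : d k0 / 2 ≤ (B (z i) a - m) ^ 2 + (B (z i) b - m) ^ 2 := by
      nlinarith [sq_nonneg ((B (z i) a - m) + (B (z i) b - m))]
    have h4 : β * n / K * (d k0 / 2) ≤
        β * n / K * ((B (z i) a - m) ^ 2 + (B (z i) b - m) ^ 2) :=
      mul_le_mul_of_nonneg_left h3 (by positivity)
    have h5 : β * n / K * (d k0 / 2) ≤ ∑ j, (B (z i) (z j) - m) ^ 2 := by
      linarith
    calc β / K * (d k0 / 2) * p ^ 2 * n = p ^ 2 * (β * n / K * (d k0 / 2)) := by ring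
      _ ≤ _ := mul_le_mul_of_nonneg_left h5 (by positivity)
  · rw [Real.sqrt_le_left (by positivity), mul_pow, Real.sq_sqrt (by positivity)]
    refine mul_le_mul_of_nonneg_left ?_ (by positivity)
    have h1 : ∑ j, (B (z i) (z j) - m) ^ 2 ≤ ∑ _j : Fin n, (1 : ℝ) := by
      refine Finset.sum_le_sum fun j _ => ?_
      obtain ⟨h0, h1⟩ := hB01 (z i) (z j)
      rw [sq_le_one_iff_abs_le_one, abs_le]
      constructor <;> linarith
    simpa using h1
end
end
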